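/- arXiv:1604.07967 — 3 statements merged into one kernel-verified Lean document; each statement's English description precedes it below -/
import Mathlib

section
/- Let n ≥ 2, let L = ℤ^n and Φ be the root system of type B_n, and let A ⊆ Φ. Then A generates ℤ^n as a ℤ-module if and only if every connected component of the graph G(A) contains at least one marked vertex; equivalently, for every i ∈ {1,…,n} there is a path in G(A) from i to some vertex j with e_j ∈ A or −e_j ∈ A. -/
/-- The standard basis vector `e i` of `ℤ^m`. -/
def std (m : ℕ) (i : Fin m) : Fin m → ℤ := Pi.single i 1

/-- The root system of type `B_n`:
`{± e_i} ∪ {± e_i ± e_j | i < j}` in `ℤ^n`. -/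
def PhiB (n : ℕ) : Set (Fin n → ℤ) :=
  {v | ∃ i : Fin n, v = std n i ∨ v = -std n i} ∪
  {v | ∃ i j : Fin n, i ≠ j ∧
    (v = std n i - std n j ∨ v = std n i + std n j ∨ v = -(std n i + std n j))}

/-- The graph `G(A)` associated to a set `A` of roots of type `B_n`: vertices `1, …, n`,
with `i ≠ j` adjacent iff one of the roots `±(e_i - e_j)`, `±(e_i + e_j)` lies in `A`. -/
def GB (n : ℕ) (A : Set (Fin n → ℤ)) : SimpleGraph (Fin n) where
  Adj i j := i ≠ j ∧
    (std n i - std n j ∈ A ∨ std n j - std n i ∈ A ∨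
     std n i + std n j ∈ A ∨ -(std n i + std n j) ∈ A)
  symm := by
    constructor
    rintro i j ⟨h1, h2⟩
    refine ⟨h1.symm, ?_⟩
    rcases h2 with h | h | h | h
    · exact Or.inr (Or.inl h)
    · exact Or.inl h
    · refine Or.inr (Or.inr (Or.inl ?_)); rwa [add_comm]
    · refine Or.inr (Or.inr (Or.inr ?_)); rwa [add_comm]
  loopless := ⟨fun i h => h.1 rfl⟩

theorem std_mem_of_reach (n : ℕ) (A : Set (Fin n → ℤ)) (i j : Fin n)
    (h : (GB n A).Reachable i j) (hj : std n j ∈ Submodule.span ℤ A) :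
    std n i ∈ Submodule.span ℤ A := by
  obtain ⟨w⟩ := h
  induction w with
  | nil => exact hj
  | @cons u v w hadj p ih =>
    have hv := ih hj
    obtain ⟨_, h | h | h | h⟩ := hadj
    · have := Submodule.add_mem _ (Submodule.subset_span h) hv
      simpa using this
    · have := Submodule.sub_mem _ hv (Submodule.subset_span h)
      simpa using this
    · have := Submodule.sub_mem _ (Submodule.subset_span h) hv
      simpa using this
    · have := Submodule.neg_mem _ (Submodule.add_mem _ (Submodule.subset_span h) hv)
      simpa using this

/-- A set `A` of roots of type `B_n` generates `ℤ^n` as a ℤ-module iff every connected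
component of `G(A)` contains a marked vertex, i.e. for every `i` there is a path in
`G(A)` from `i` to some `j` with `e_j ∈ A` or `-e_j ∈ A`. -/
theorem stmt9 (n : ℕ) (hn : 2 ≤ n) (A : Set (Fin n → ℤ)) (hA : A ⊆ PhiB n) :
    Submodule.span ℤ A = ⊤ ↔
      ∀ i : Fin n, ∃ j : Fin n, (GB n A).Reachable i j ∧ (std n j ∈ A ∨ -std n j ∈ A) := by
  classical
  constructor
  · intro hs i
    by_contra hcon
    push Not at hcon
    let c : Fin n → ZMod 2 := fun k => if (GB n A).Reachable i k then 1 else 0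
    let f : (Fin n → ℤ) →ₗ[ℤ] ZMod 2 := Fintype.linearCombination ℤ c
    have hf : ∀ k, f (std n k) = c k := by
      intro k
      simp [f, std, Fintype.linearCombination_apply_single]
    have two : ∀ x : ZMod 2, x + x = 0 := by decide
    have hadj : ∀ a b, (GB n A).Adj a b → c a = c b := by
      intro a b hab
      have : (GB n A).Reachable i a ↔ (GB n A).Reachable i b :=
        ⟨fun h => h.trans hab.reachable, fun h => h.trans hab.symm.reachable⟩
      simp only [c, this]
    have hle : Submodule.span ℤ A ≤ LinearMap.ker f := by
      rw [Submodule.span_le]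
      intro v hv
      rw [SetLike.mem_coe, LinearMap.mem_ker]
      rcases hA hv with ⟨k, hk⟩ | ⟨a, b, hab, hk⟩
      · have hnr : ¬ (GB n A).Reachable i k := by
          intro hr
          rcases hk with rfl | rfl
          · exact (hcon k hr).1 hv
          · exact (hcon k hr).2 hv
        have hc : c k = 0 := if_neg hnr
        rcases hk with rfl | rfl <;> simp [hf, hc]
      · have hc : c a = c b := by
          apply hadj
          refine ⟨hab, ?_⟩
          rcases hk with rfl | rfl | rfl <;> simp only [hv, true_or, or_true]
        rcases hk with rfl | rfl | rfl
        · rw [map_sub, hf, hf, hc, sub_self]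
        · rw [map_add, hf, hf, hc, two]
        · rw [map_neg, map_add, hf, hf, hc, two, neg_zero]
    have h1 : f (std n i) = 0 := by
      have : std n i ∈ Submodule.span ℤ A := by rw [hs]; trivial
      exact hle this
    have hci : c i = 1 := if_pos (SimpleGraph.Reachable.refl i)
    rw [hf, hci] at h1
    exact one_ne_zero h1
  · intro h
    rw [eq_top_iff]
    have hstd : ∀ i, std n i ∈ Submodule.span ℤ A := by
      intro i
      obtain ⟨j, hr, hj⟩ := h i
      apply std_mem_of_reach n A i j hr
      rcases hj with hj | hj
      · exact Submodule.subset_span hj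
      · have := Submodule.neg_mem _ (Submodule.subset_span (R := ℤ) hj)
        simpa using this
    intro v _
    rw [pi_eq_sum_univ' v]
    refine Submodule.sum_mem _ fun k _ => ?_
    have := Submodule.smul_mem _ (v k) (hstd k)
    convert this using 1
    ext l
    simp [std, Pi.single_apply, eq_comm]
end

section
/- Let n ≥ 1, let L and Φ be the root lattice of type A_n, let A ⊆ Φ, and let L_1 be the ℤ-submodule of L generated by A. If c is the number of connected components of the graph G(A), then the abelian group L/L_1 is isomorphic to ℤ^{c−1}. -/
/-- The root system of type `A_n`: `{± (e_i - e_j) | 1 ≤ i < j ≤ n+1}` in `ℤ^{n+1}`. -/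
def PhiA (n : ℕ) : Set (Fin (n + 1) → ℤ) :=
  {v | ∃ i j : Fin (n + 1), i ≠ j ∧ v = std (n + 1) i - std (n + 1) j}

/-- The root lattice of type `A_n`: `{x ∈ ℤ^{n+1} | Σ_i x_i = 0}`. -/
def LA (n : ℕ) : Submodule ℤ (Fin (n + 1) → ℤ) :=
  LinearMap.ker (∑ i : Fin (n + 1), (LinearMap.proj i : (Fin (n + 1) → ℤ) →ₗ[ℤ] ℤ))

/-- The graph `G(A)` associated to a set `A` of roots of type `A_n`: vertices `1, …, n+1`,
with `i` and `j` adjacent iff `e_i - e_j ∈ A` or `e_j - e_i ∈ A`. -/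
def GA (n : ℕ) (A : Set (Fin (n + 1) → ℤ)) : SimpleGraph (Fin (n + 1)) where
  Adj i j := i ≠ j ∧
    (std (n + 1) i - std (n + 1) j ∈ A ∨ std (n + 1) j - std (n + 1) i ∈ A)
  symm := ⟨fun i j h => ⟨h.1.symm, h.2.symm⟩⟩
  loopless := ⟨fun i h => h.1 rfl⟩

open Classical in
/-- Sum of the coordinates over each connected component. -/
noncomputable def compSum (n : ℕ) (G : SimpleGraph (Fin (n + 1))) :
    (Fin (n + 1) → ℤ) →ₗ[ℤ] (G.ConnectedComponent → ℤ) where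
  toFun x C := ∑ i, if G.connectedComponentMk i = C then x i else 0
  map_add' x y := by
    funext C
    simp only [Pi.add_apply, ← Finset.sum_add_distrib]
    refine Finset.sum_congr rfl fun i _ => ?_
    split_ifs <;> simp
  map_smul' a x := by
    funext C
    simp [Finset.mul_sum]

open Classical in
lemma compSum_apply (n : ℕ) (G : SimpleGraph (Fin (n + 1))) (x : Fin (n + 1) → ℤ)
    (C : G.ConnectedComponent) :
    compSum n G x C = ∑ i, if G.connectedComponentMk i = C then x i else 0 := rfl

open Classical in
lemma compSum_std (n : ℕ) (G : SimpleGraph (Fin (n + 1))) (j : Fin (n + 1)) :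
    compSum n G (std (n + 1) j) = Pi.single (G.connectedComponentMk j) 1 := by
  funext C
  rw [compSum_apply, Finset.sum_eq_single j]
  · simp [std, Pi.single_apply, eq_comm]
  · intro b _ hb
    simp [std, hb]
  · simp

lemma mem_LA (n : ℕ) (x : Fin (n + 1) → ℤ) : x ∈ LA n ↔ ∑ i, x i = 0 := by
  simp [LA, LinearMap.mem_ker]

lemma reach_mem (n : ℕ) (A : Set (Fin (n + 1) → ℤ)) (i j : Fin (n + 1))
    (h : (GA n A).Reachable i j) :
    std (n + 1) i - std (n + 1) j ∈ Submodule.span ℤ A := by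
  obtain ⟨w⟩ := h
  induction w with
  | nil => simp
  | cons h p ih =>
    rename_i u v w
    have h1 : std (n + 1) u - std (n + 1) v ∈ Submodule.span ℤ A := by
      rcases h.2 with h | h
      · exact Submodule.subset_span h
      · rw [← neg_sub]
        exact Submodule.neg_mem _ (Submodule.subset_span h)
    have := Submodule.add_mem _ h1 ih
    simpa using this

lemma compSum_total (n : ℕ) (G : SimpleGraph (Fin (n + 1))) [Fintype G.ConnectedComponent]
    (x : Fin (n + 1) → ℤ) :
    ∑ C, compSum n G x C = ∑ i, x i := by
  classical
  simp only [compSum_apply]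
  rw [Finset.sum_comm]
  simp

lemma span_eq_ker (n : ℕ) (A : Set (Fin (n + 1) → ℤ)) (hA : A ⊆ PhiA n) :
    Submodule.span ℤ A = LinearMap.ker (compSum n (GA n A)) := by
  classical
  apply le_antisymm
  · rw [Submodule.span_le]
    intro v hv
    obtain ⟨i, j, hij, rfl⟩ := hA hv
    have hadj : (GA n A).Adj i j := ⟨hij, Or.inl hv⟩
    have : (GA n A).connectedComponentMk i = (GA n A).connectedComponentMk j :=
      SimpleGraph.ConnectedComponent.sound hadj.reachable
    simp [LinearMap.mem_ker, compSum_std, this]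
  · intro x hx
    have : Fintype (GA n A).ConnectedComponent := Fintype.ofFinite _
    rw [LinearMap.mem_ker] at hx
    let r : Fin (n + 1) → Fin (n + 1) := fun i => ((GA n A).connectedComponentMk i).out
    have h1 : ∑ i, x i • (std (n + 1) i - std (n + 1) (r i)) ∈ Submodule.span ℤ A := by
      refine Submodule.sum_mem _ fun i _ => Submodule.smul_mem _ _ (reach_mem n A _ _ ?_)
      apply SimpleGraph.ConnectedComponent.exact
      exact (Quot.out_eq _).symm
    have h2 : ∑ i, x i • std (n + 1) (r i) = 0 := by
      have : ∑ i, x i • std (n + 1) (r i)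
          = ∑ C, compSum n (GA n A) x C • std (n + 1) (Quot.out C) := by
        simp only [compSum_apply, Finset.sum_smul, ite_smul, zero_smul]
        rw [Finset.sum_comm]
        simp [r]
      rw [this, hx]
      simp
    have h3 : ∑ i, x i • std (n + 1) i = x := by
      funext k
      simp [std, Pi.single_apply]
    simp only [smul_sub, Finset.sum_sub_distrib] at h1
    rwa [h2, h3, sub_zero] at h1

/-- If `A` is a set of roots of type `A_n` generating the subroot lattice
`L₁ = span ℤ A ⊆ L(A_n)`, and `c` is the number of connected components of `G(A)`,
then `L/L₁ ≅ ℤ^{c-1}` as abelian groups. -/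
theorem stmt10 (n : ℕ) (hn : 1 ≤ n) (A : Set (Fin (n + 1) → ℤ)) (hA : A ⊆ PhiA n)
    (c : ℕ) (hc : c = Nat.card (GA n A).ConnectedComponent) :
    Nonempty
      ((↥(LA n) ⧸ Submodule.comap (LA n).subtype (Submodule.span ℤ A)) ≃+
        (Fin (c - 1) → ℤ)) := by
  classical
  have : Fintype (GA n A).ConnectedComponent := Fintype.ofFinite _
  let C0 : (GA n A).ConnectedComponent := (GA n A).connectedComponentMk 0
  let S := {C : (GA n A).ConnectedComponent // C ≠ C0}
  let f : LA n →ₗ[ℤ] (S → ℤ) :=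
    (LinearMap.funLeft ℤ ℤ (Subtype.val : S → _)).comp
      ((compSum n (GA n A)).comp (LA n).subtype)
  have hf : ∀ x C, f x C = compSum n (GA n A) x.1 C.1 := fun x C => rfl
  have hker : Submodule.comap (LA n).subtype (Submodule.span ℤ A) = LinearMap.ker f := by
    rw [span_eq_ker n A hA]
    ext x
    rw [Submodule.mem_comap, LinearMap.mem_ker, LinearMap.mem_ker]
    constructor
    · intro h
      funext C
      rw [hf]
      exact congrFun h C.1
    · intro h
      have h0 : ∀ C, C ≠ C0 → compSum n (GA n A) x.1 C = 0 := fun C hC => congrFun h ⟨C, hC⟩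
      have ht := compSum_total n (GA n A) x.1
      rw [(mem_LA n x.1).1 x.2, Finset.sum_eq_single C0 (fun b _ hb => h0 b hb) (by simp)] at ht
      funext C
      by_cases hC : C = C0
      · rw [hC]; exact ht
      · exact h0 C hC
  have hsurj : Function.Surjective f := by
    intro y
    have hmem : ∑ C : S, y C • (std (n + 1) (Quot.out C.1) - std (n + 1) 0) ∈ LA n := by
      refine Submodule.sum_mem _ fun C _ => Submodule.smul_mem _ _ ?_
      rw [mem_LA]
      simp [std]
    refine ⟨⟨_, hmem⟩, ?_⟩
    funext D
    have hout : ∀ C : (GA n A).ConnectedComponent,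
        (GA n A).connectedComponentMk (Quot.out C) = C := fun C => Quot.out_eq C
    rw [hf]
    simp only [map_sum, map_smul, map_sub, compSum_std, hout, Finset.sum_apply, Pi.smul_apply,
      Pi.sub_apply]
    rw [Finset.sum_eq_single D]
    · have : D.1 ≠ (GA n A).connectedComponentMk 0 := D.2
      simp [this]
    · intro b _ hb
      have h1 : D.1 ≠ (GA n A).connectedComponentMk 0 := D.2
      have h2 : D.1 ≠ b.1 := fun h => hb (Subtype.ext h.symm)
      simp [h1, h2]
    · simp
  have hcard : Fintype.card S = c - 1 := by
    rw [hc, Nat.card_eq_fintype_card]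
    simp [S, Fintype.card_subtype_compl]
  have e : S ≃ Fin (c - 1) := Fintype.equivFinOfCardEq hcard
  exact ⟨(((Submodule.quotEquivOfEq _ _ hker).trans
    (f.quotKerEquivOfSurjective hsurj)).trans (LinearEquiv.funCongrLeft ℤ ℤ e.symm)).toAddEquiv⟩
end

section
/- Let n ≥ 2, let L = ℤ^n and Φ be the root system of type B_n with Weyl group W. An element w ∈ W is a quasi Coxeter element — i.e. there exist roots α_1,…,α_n ∈ Φ with w = s_{α_1} ∘ ⋯ ∘ s_{α_n} and Σ_{i=1}^n ℤα_i = ℤ^n — if and only if every cycle of w is negative. -/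
/-- The standard scalar product on `ℤ^m`. -/
def dotZ {m : ℕ} (x y : Fin m → ℤ) : ℤ := ∑ i, x i * y i

/-- The reflection `s_α : x ↦ x - (2(x,α)/(α,α)) • α` (the division is exact for every
root `α` of the systems considered here, so this is the honest reflection). -/
def reflZ {m : ℕ} (α : Fin m → ℤ) (x : Fin m → ℤ) : Fin m → ℤ :=
  x - ((2 * dotZ x α) / dotZ α α) • α

/-- The signed permutation determined by `σ` and signs `ε`, i.e. the ℤ-linear map with
`w(e_i) = ε_i • e_{σ(i)}`. -/
def wSigned {n : ℕ} (σ : Equiv.Perm (Fin n)) (ε : Fin n → ℤ) :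
    (Fin n → ℤ) → (Fin n → ℤ) :=
  fun x j => ε (σ⁻¹ j) * x (σ⁻¹ j)


theorem dotZ_eq {m : ℕ} (x y : Fin m → ℤ) : dotZ x y = x ⬝ᵥ y := rfl

theorem std_self {n : ℕ} (i : Fin n) : std n i i = 1 := by simp [std]

theorem std_ne {n : ℕ} {i j : Fin n} (h : j ≠ i) : std n i j = 0 := by
  simp [std, h]

theorem dot_std {n : ℕ} (x : Fin n → ℤ) (i : Fin n) : x ⬝ᵥ std n i = x i := by
  simp [std]

theorem root_norm {n : ℕ} {α : Fin n → ℤ} (h : α ∈ PhiB n) :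
    dotZ α α = 1 ∨ dotZ α α = 2 := by
  rw [dotZ_eq]
  rcases h with ⟨i, h | h⟩ | ⟨i, j, hij, h | h | h⟩
  · subst h; simp [dot_std, std_self]
  · subst h; simp [dot_std, std_self]
  all_goals
    subst h
    simp [dot_std, std_self, std_ne hij, std_ne hij.symm]

theorem coroot {n : ℕ} {α : Fin n → ℤ} (h : α ∈ PhiB n) :
    ∃ φ : (Fin n → ℤ) →ₗ[ℤ] ℤ, ∀ x, reflZ α x = x - φ x • α ∧ (φ x = 0 → dotZ x α = 0) := by
  let D : (Fin n → ℤ) →ₗ[ℤ] ℤ :=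
    { toFun := fun x => dotZ x α
      map_add' := fun x y => by simp [dotZ_eq]
      map_smul' := fun c x => by rw [dotZ_eq, dotZ_eq, smul_dotProduct]; rfl }
  have hD : ∀ x, D x = dotZ x α := fun x => rfl
  rcases root_norm h with h | h
  · refine ⟨(2 : ℤ) • D, fun x => ⟨?_, ?_⟩⟩
    · simp [reflZ, h, hD]
    · simp [hD]
  · refine ⟨D, fun x => ⟨?_, ?_⟩⟩
    · simp [reflZ, h, hD]
    · simp [hD]

theorem refl_lin {n : ℕ} {α : Fin n → ℤ} (h : α ∈ PhiB n) :
    ∃ f : (Fin n → ℤ) →ₗ[ℤ] (Fin n → ℤ), ∀ x, f x = reflZ α x := by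
  obtain ⟨φ, hφ⟩ := coroot h
  exact ⟨LinearMap.id - φ.smulRight α, fun x => by simp [(hφ x).1]⟩

theorem refl_std {n : ℕ} (i : Fin n) (x : Fin n → ℤ) :
    reflZ (std n i) x = x - (2 * x i) • std n i := by
  simp [reflZ, dotZ_eq, dot_std, std_self]

theorem refl_diff {n : ℕ} {i j : Fin n} (hij : i ≠ j) {c : ℤ} (hc : c = 1 ∨ c = -1)
    (x : Fin n → ℤ) :
    reflZ (std n i - c • std n j) x = x - (x i - c * x j) • (std n i - c • std n j) := by
  have h2 : dotZ (std n i - c • std n j) (std n i - c • std n j) = 2 := by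
    rw [dotZ_eq]
    rcases hc with rfl | rfl <;>
    simp [dot_std, std_self, std_ne hij, std_ne hij.symm]
  have h1 : dotZ x (std n i - c • std n j) = x i - c * x j := by
    rw [dotZ_eq, dotProduct_sub, dotProduct_smul, dot_std, dot_std, smul_eq_mul]
  rw [reflZ, h1, h2]
  simp

theorem refl_invol {n : ℕ} {i j : Fin n} (hij : i ≠ j) {c : ℤ} (hc : c = 1 ∨ c = -1)
    (x : Fin n → ℤ) :
    reflZ (std n i - c • std n j) (reflZ (std n i - c • std n j) x) = x := by
  rw [refl_diff hij hc, refl_diff hij hc]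
  have hcc : c * c = 1 := by rcases hc with rfl | rfl <;> simp
  ext p
  simp only [Pi.sub_apply, Pi.smul_apply, smul_eq_mul, std_self, std_ne hij, std_ne hij.symm]
  linear_combination (-(x i - c * x j) * (std n i p - c * std n j p)) * (-hcc)

theorem refl_std_invol {n : ℕ} (i : Fin n) (x : Fin n → ℤ) :
    reflZ (std n i) (reflZ (std n i) x) = x := by
  rw [refl_std, refl_std]
  ext p
  simp only [Pi.sub_apply, Pi.smul_apply, smul_eq_mul, std_self]
  ring

theorem lin_ext {n : ℕ} {f g : (Fin n → ℤ) →ₗ[ℤ] (Fin n → ℤ)}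
    (h : ∀ i, f (std n i) = g (std n i)) : f = g := by
  apply (Pi.basisFun ℤ (Fin n)).ext
  intro i
  simpa [std] using h i

theorem std_ne_neg {n : ℕ} (m : Fin n) : std n m ≠ - std n m := by
  intro h
  have := congrFun h m
  simp [std_self] at this

theorem construct {n : ℕ} : ∀ (N : ℕ) (S : Finset (Fin n)) (_ : S.card = N)
    (w : (Fin n → ℤ) →ₗ[ℤ] (Fin n → ℤ)) (_ : Function.Injective w)
    (_ : ∀ p, ∃ q, ∃ d : ℤ, (d = 1 ∨ d = -1) ∧ w (std n p) = d • std n q)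
    (_ : ∀ i, i ∉ S → w (std n i) = std n i)
    (_ : ∀ i, i ∈ S → ∃ k : ℕ, w^[k] (std n i) = - std n i),
    ∃ l : List (Fin n → ℤ), l.length = N ∧ (∀ α ∈ l, α ∈ PhiB n) ∧
      l.foldr (fun α f => reflZ α ∘ f) id = w ∧
      ∀ i ∈ S, std n i ∈ Submodule.span ℤ {α | α ∈ l} := by
  intro N
  induction N with
  | zero =>
    intro S hS w _ _ hfix _
    have : S = ∅ := by simpa using hS
    subst this
    refine ⟨[], rfl, by simp, ?_, by simp⟩
    have : w = LinearMap.id := lin_ext (fun i => by simpa using hfix i (by simp))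
    rw [this]; rfl
  | succ N ih =>
    intro S hS w hinj hsg hfix hneg
    obtain ⟨i, hi⟩ : S.Nonempty := by
      rw [← Finset.card_pos]; omega
    have hcard : (S.erase i).card = N := by rw [Finset.card_erase_of_mem hi]; omega
    obtain ⟨j, c, hc, hw⟩ := hsg i
    have hcc : c * c = 1 := by rcases hc with rfl | rfl <;> simp
    -- no other basis vector is sent to the line of `e_j`
    have hne : ∀ p q (d : ℤ), (d = 1 ∨ d = -1) → w (std n p) = d • std n q → p ≠ i → q ≠ j := by
      rintro p q d hd hpq hpi rfl
      have h1 : w (std n p) = w ((d * c) • std n i) := by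
        rw [map_smul, hw, hpq, smul_smul, mul_assoc, hcc, mul_one]
      have h2 := congrFun (hinj h1) p
      simp [std_self, std_ne hpi] at h2
    by_cases hij : i = j
    · subst hij
      -- fixed point, sign must be -1
      have hc1 : c = -1 := by
        rcases hc with rfl | rfl
        · exfalso
          obtain ⟨k, hk⟩ := hneg i hi
          have : w^[k] (std n i) = std n i :=
            Function.iterate_fixed (by simpa using hw) k
          exact std_ne_neg i (this.symm.trans hk)
        · rfl
      subst hc1
      have hroot : std n i ∈ PhiB n := Or.inl ⟨i, Or.inl rfl⟩
      obtain ⟨f, hf⟩ := refl_lin hroot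
      have key : ∀ p, p ≠ i → (f ∘ₗ w) (std n p) = w (std n p) := by
        intro p hp
        obtain ⟨q, d, hd, hpq⟩ := hsg p
        have hq := hne p q d hd hpq hp
        rw [LinearMap.comp_apply, hf, refl_std, hpq]
        simp [std_ne hq.symm]
      have keyi : (f ∘ₗ w) (std n i) = std n i := by
        rw [LinearMap.comp_apply, hf, refl_std, hw]
        ext p
        simp [std_self]
        ring
      obtain ⟨l, hl, hr, hprod, hspan⟩ := ih (S.erase i) hcard (f ∘ₗ w)
        (by
          have : Function.Injective f := by
            intro x y hxy
            rw [hf, hf] at hxy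
            rw [← refl_std_invol i x, hxy, refl_std_invol]
          exact this.comp hinj)
        (by
          intro p
          by_cases hp : p = i
          · subst hp; exact ⟨p, 1, Or.inl rfl, by simpa using keyi⟩
          · rw [key p hp]; exact hsg p)
        (by
          intro p hp
          by_cases hpi : p = i
          · subst hpi; exact keyi
          · rw [key p hpi]; exact hfix p (fun h => hp (Finset.mem_erase.2 ⟨hpi, h⟩)))
        (by
          intro m hm
          obtain ⟨hmi, hmS⟩ := Finset.mem_erase.1 hm
          have : ∀ k : ℕ, ∃ p, p ≠ i ∧ ∃ b : ℤ, (b = 1 ∨ b = -1) ∧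
              w^[k] (std n m) = b • std n p ∧ (f ∘ₗ w)^[k] (std n m) = b • std n p := by
            intro k
            induction k with
            | zero => exact ⟨m, hmi, 1, Or.inl rfl, by simp, by simp⟩
            | succ k ihk =>
              obtain ⟨p, hp, b, hb, h1, h2⟩ := ihk
              obtain ⟨q, d, hd, hpq⟩ := hsg p
              refine ⟨q, hne p q d hd hpq hp, b * d, ?_, ?_, ?_⟩
              · rcases hb with rfl | rfl <;> rcases hd with rfl | rfl <;> simp
              · rw [Function.iterate_succ_apply', h1, map_smul, hpq, smul_smul]
              · rw [Function.iterate_succ_apply', h2, map_smul, key p hp, hpq, smul_smul]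
          obtain ⟨k, hk⟩ := hneg m hmS
          obtain ⟨p, _, b, _, h1, h2⟩ := this k
          exact ⟨k, by rw [h2, ← h1, hk]⟩)
      refine ⟨std n i :: l, by simp [hl], ?_, ?_, ?_⟩
      · intro α hα
        rcases List.mem_cons.1 hα with rfl | h
        · exact hroot
        · exact hr α h
      · rw [List.foldr_cons, hprod]
        funext x
        simp only [Function.comp_apply, LinearMap.comp_apply]
        rw [hf, refl_std_invol]
      · intro p hp
        by_cases hpi : p = i
        · subst hpi; exact Submodule.subset_span (by simp)
        · exact Submodule.span_mono (fun x hx => List.mem_cons_of_mem _ hx)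
            (hspan p (Finset.mem_erase.2 ⟨hpi, hp⟩))
    · have hji : j ≠ i := fun h => hij h.symm
      set α := std n i - c • std n j with hα
      have hroot : α ∈ PhiB n := by
        refine Or.inr ⟨i, j, hij, ?_⟩
        rcases hc with rfl | rfl
        · left; simp [hα]
        · right; left; simp [hα]
      have hjS : j ∈ S := by
        by_contra hj
        have h1 := hfix j hj
        exact hne j j 1 (Or.inl rfl) (by simpa using h1) hji rfl
      obtain ⟨f, hf⟩ := refl_lin hroot
      let π : (Fin n → ℤ) → (Fin n → ℤ) := fun x => x - x i • α
      have hπ : ∀ x, π x = x - x i • α := fun x => rfl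
      have hfπ : ∀ x : Fin n → ℤ, x j = 0 → f x = π x := by
        intro x hx
        rw [hf, hα, refl_diff hij hc, hx, hπ]; simp [hα]
      have keyi : (f ∘ₗ w) (std n i) = std n i := by
        rw [LinearMap.comp_apply, hf, hα, refl_diff hij hc, hw]
        ext p
        simp only [Pi.sub_apply, Pi.smul_apply, smul_eq_mul, std_self, std_ne hij]
        linear_combination (std n i p - c * std n j p) * hcc
      have key : ∀ p, p ≠ i → (f ∘ₗ w) (std n p) = π (w (std n p)) := by
        intro p hp
        obtain ⟨q, d, hd, hpq⟩ := hsg p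
        have hq := hne p q d hd hpq hp
        rw [LinearMap.comp_apply, hfπ]
        rw [hpq]
        simp [std_ne hq.symm]
      have πfix : ∀ x : Fin n → ℤ, x i = 0 → π x = x := by
        intro x hx; rw [hπ, hx]; simp
      have πi : ∀ b : ℤ, π (b • std n i) = (b * c) • std n j := by
        intro b
        rw [hπ, hα]
        ext p
        simp only [Pi.sub_apply, Pi.smul_apply, smul_eq_mul, std_self]
        ring
      have πsmul : ∀ (b : ℤ) x, π (b • x) = b • π x := by
        intro b x
        rw [hπ, hπ]
        ext p
        simp only [Pi.sub_apply, Pi.smul_apply, smul_eq_mul]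
        ring
      obtain ⟨l, hl, hr, hprod, hspan⟩ := ih (S.erase i) hcard (f ∘ₗ w)
        (by
          have : Function.Injective f := by
            intro x y hxy
            rw [hf, hf] at hxy
            rw [← refl_invol hij hc x, ← hα, hxy, hα, refl_invol hij hc]
          exact this.comp hinj)
        (by
          intro p
          by_cases hp : p = i
          · subst hp; exact ⟨p, 1, Or.inl rfl, by simpa using keyi⟩
          · rw [key p hp]
            obtain ⟨q, d, hd, hpq⟩ := hsg p
            rw [hpq]
            by_cases hq : q = i
            · subst hq
              refine ⟨j, d * c, ?_, πi d⟩
              rcases hc with rfl | rfl <;> rcases hd with rfl | rfl <;> simp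
            · exact ⟨q, d, hd, πfix _ (by simp [std_ne (Ne.symm hq)])⟩)
        (by
          intro p hp
          by_cases hpi : p = i
          · subst hpi; exact keyi
          · rw [key p hpi, hfix p (fun h => hp (Finset.mem_erase.2 ⟨hpi, h⟩))]
            exact πfix _ (std_ne (Ne.symm hpi)))
        (by
          intro m hm
          obtain ⟨hmi, hmS⟩ := Finset.mem_erase.1 hm
          have hmi' : i ≠ m := fun h => hmi h.symm
          have : ∀ k : ℕ, ∃ k' : ℕ, ∃ p, ∃ b : ℤ,
              w^[k] (std n m) = b • std n p ∧ (f ∘ₗ w)^[k'] (std n m) = π (b • std n p) := by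
            intro k
            induction k with
            | zero =>
              exact ⟨0, m, 1, by simp, by
                rw [πfix _ (by simp [std_ne hmi'])]; simp⟩
            | succ k ihk =>
              obtain ⟨k', p, b, h1, h2⟩ := ihk
              obtain ⟨q, d, hd, hpq⟩ := hsg p
              have h3 : w^[k+1] (std n m) = (b * d) • std n q := by
                rw [Function.iterate_succ_apply', h1, map_smul, hpq, smul_smul]
              by_cases hp : p = i
              · subst hp
                refine ⟨k', j, b * c, ?_, ?_⟩
                · rw [Function.iterate_succ_apply', h1, map_smul, hw, smul_smul]
                · rw [h2, πi, πfix _ (by simp [std_ne hij])]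
              · refine ⟨k' + 1, q, b * d, h3, ?_⟩
                rw [Function.iterate_succ_apply', h2,
                  πfix _ (by simp [std_ne (Ne.symm hp)]), map_smul, key p hp, hpq,
                  ← πsmul, smul_smul]
          obtain ⟨k, hk⟩ := hneg m hmS
          obtain ⟨k', p, b, h1, h2⟩ := this k
          exact ⟨k', by rw [h2, ← h1, hk]; exact πfix _ (by simp [std_ne hmi'])⟩)
      have hmono : Submodule.span ℤ {β | β ∈ l} ≤ Submodule.span ℤ {β | β ∈ α :: l} :=
        Submodule.span_mono (fun x hx => List.mem_cons_of_mem _ hx)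
      refine ⟨α :: l, by simp [hl], ?_, ?_, ?_⟩
      · intro β hβ
        rcases List.mem_cons.1 hβ with rfl | h
        · exact hroot
        · exact hr β h
      · rw [List.foldr_cons, hprod]
        funext x
        simp only [Function.comp_apply, LinearMap.comp_apply]
        rw [hf, hα, refl_invol hij hc]
      · intro p hp
        by_cases hpi : p = i
        · subst hpi
          have h1 : std n p = α + c • std n j := by rw [hα]; simp
          rw [h1]
          refine Submodule.add_mem _ (Submodule.subset_span (by simp))
            (Submodule.smul_mem _ _ (hmono (hspan j (Finset.mem_erase.2 ⟨hji, hjS⟩))))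
        · exact hmono (hspan p (Finset.mem_erase.2 ⟨hpi, hp⟩))

theorem foldr_expand {n : ℕ} (x : Fin n → ℤ) : ∀ l : List (Fin n → ℤ), (∀ α ∈ l, α ∈ PhiB n) →
    ∃ c : Fin l.length → ℤ, l.foldr (fun α f => reflZ α ∘ f) id x = x - ∑ k, c k • l.get k ∧
      (c = 0 → ∀ α ∈ l, dotZ x α = 0) := by
  intro l
  induction l with
  | nil => intro _; exact ⟨0, by simp, by simp⟩
  | cons α l ih =>
    intro h
    obtain ⟨c, hc, hc0⟩ := ih (fun β hβ => h β (List.mem_cons_of_mem _ hβ))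
    obtain ⟨φ, hφ⟩ := coroot (h α (by simp))
    set y := l.foldr (fun α f => reflZ α ∘ f) id x with hy
    refine ⟨Fin.cons (φ y) c, ?_, ?_⟩
    · rw [List.foldr_cons, Function.comp_apply, ← hy, (hφ y).1]
      have : ∑ k : Fin (α :: l).length, (Fin.cons (φ y) c : Fin (l.length + 1) → ℤ) k • (α :: l).get k
          = φ y • α + ∑ k, c k • l.get k := by
        exact (Fin.sum_univ_succ (n := l.length) _).trans (by simp)
      rw [this]
      nth_rewrite 1 [hc]
      abel
    · intro h0
      have h1 : φ y = 0 := congrFun h0 (0 : Fin (l.length + 1))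
      have h2 : c = 0 := by
        funext k; exact congrFun h0 (Fin.succ k)
      have h3 : y = x := by rw [hc, h2]; simp
      intro β hβ
      rcases List.mem_cons.1 hβ with rfl | hβ
      · rw [h3] at h1; exact (hφ x).2 h1
      · exact hc0 h2 β hβ

theorem no_fixed {n : ℕ} (l : List (Fin n → ℤ)) (hl : l.length = n) (hr : ∀ α ∈ l, α ∈ PhiB n)
    (hs : Submodule.span ℤ {α | α ∈ l} = ⊤) (x : Fin n → ℤ)
    (hx : l.foldr (fun α f => reflZ α ∘ f) id x = x) : x = 0 := by
  obtain ⟨c, hc, hc0⟩ := foldr_expand x l hr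
  rw [hx] at hc
  have hsum : ∑ k, c k • l.get k = 0 := sub_eq_self.1 hc.symm
  have hsurj : Function.Surjective (Fintype.linearCombination ℤ l.get) := by
    rw [← LinearMap.range_eq_top, Fintype.range_linearCombination, Set.range_list_get]
    exact hs
  let E : (Fin l.length → ℤ) ≃ₗ[ℤ] (Fin n → ℤ) := LinearEquiv.funCongrLeft ℤ ℤ (finCongr hl).symm
  have hinj : Function.Injective (Fintype.linearCombination ℤ l.get) :=
    OrzechProperty.injective_of_surjective_of_injective E.toLinearMap _ E.injective hsurj
  have hcz : c = 0 := hinj (by rw [Fintype.linearCombination_apply, hsum, map_zero])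
  have hd := hc0 hcz
  have hall : ∀ y ∈ Submodule.span ℤ {α | α ∈ l}, dotZ x y = 0 := by
    intro y hy
    induction hy using Submodule.span_induction with
    | mem y hy => exact hd y hy
    | zero => simp [dotZ_eq]
    | add y z _ _ h1 h2 => rw [dotZ_eq] at *; rw [dotProduct_add, h1, h2, add_zero]
    | smul a y _ h1 => rw [dotZ_eq] at *; rw [dotProduct_smul, h1, smul_zero]
  funext i
  have := hall (std n i) (by rw [hs]; trivial)
  rw [dotZ_eq, dot_std] at this
  exact this

/-- The signed permutation as a linear map. -/
def wLin {n : ℕ} (σ : Equiv.Perm (Fin n)) (ε : Fin n → ℤ) :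
    (Fin n → ℤ) →ₗ[ℤ] (Fin n → ℤ) where
  toFun := wSigned σ ε
  map_add' x y := by funext j; simp [wSigned, mul_add]
  map_smul' c x := by funext j; simp [wSigned]; ring

theorem wLin_std {n : ℕ} (σ : Equiv.Perm (Fin n)) (ε : Fin n → ℤ) (p : Fin n) :
    wLin σ ε (std n p) = ε p • std n (σ p) := by
  funext j
  change ε (σ⁻¹ j) * std n p (σ⁻¹ j) = ε p * std n (σ p) j
  by_cases h : j = σ p
  · subst h; simp [std_self]
  · have : σ⁻¹ j ≠ p := by rintro rfl; simp at h
    rw [std_ne h, std_ne this]; simp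

theorem wLin_iter {n : ℕ} (σ : Equiv.Perm (Fin n)) (ε : Fin n → ℤ)
    (hε : ∀ i, ε i = 1 ∨ ε i = -1) (p : Fin n) (k : ℕ) :
    ∃ b : ℤ, (b = 1 ∨ b = -1) ∧ (wLin σ ε)^[k] (std n p) = b • std n ((σ ^ k) p) := by
  induction k with
  | zero => exact ⟨1, Or.inl rfl, by simp⟩
  | succ k ih =>
    obtain ⟨b, hb, h⟩ := ih
    refine ⟨b * ε ((σ ^ k) p), ?_, ?_⟩
    · rcases hb with rfl | rfl <;> rcases hε ((σ ^ k) p) with h | h <;> simp [h]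
    · rw [Function.iterate_succ_apply', h, map_smul, wLin_std, smul_smul, pow_succ',
        Equiv.Perm.mul_apply]

/-- A signed permutation `w` (an element of the Weyl group of type `B_n`) is a quasi
Coxeter element iff every cycle of `w` is negative, i.e. for every `i` there is `k > 0`
with `w^k (e_i) = -e_i`. -/
theorem stmt12 (n : ℕ) (hn : 2 ≤ n) (σ : Equiv.Perm (Fin n)) (ε : Fin n → ℤ)
    (hε : ∀ i, ε i = 1 ∨ ε i = -1) :
    (∃ l : List (Fin n → ℤ), l.length = n ∧ (∀ α ∈ l, α ∈ PhiB n) ∧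
      l.foldr (fun α f => reflZ α ∘ f) id = wSigned σ ε ∧
      Submodule.span ℤ {α | α ∈ l} = ⊤) ↔
    (∀ i : Fin n, ∃ k : ℕ, 0 < k ∧ (wSigned σ ε)^[k] (std n i) = -std n i) := by
  have hcoe : wSigned σ ε = ⇑(wLin σ ε) := rfl
  rw [hcoe]
  constructor
  · rintro ⟨l, hl, hr, hprod, hs⟩ i
    by_contra hcon
    push Not at hcon
    set w := wLin σ ε with hw
    set N := orderOf σ with hN
    have hNpos : 0 < N := orderOf_pos σ
    have hNfix : w^[N] (std n i) = std n i := by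
      obtain ⟨b, hb, h⟩ := wLin_iter σ ε hε i N
      rw [hN, pow_orderOf_eq_one] at h
      rcases hb with rfl | rfl
      · simpa using h
      · exact absurd (by simpa using h) (hcon N hNpos)
    let x := ∑ k ∈ Finset.range N, w^[k] (std n i)
    have hx : w x = x := by
      have h1 : w x = ∑ k ∈ Finset.range N, w^[k+1] (std n i) := by
        simp only [x, map_sum, Function.iterate_succ_apply']
      have h2 := Finset.sum_range_succ (fun k => w^[k] (std n i)) N
      have h3 := Finset.sum_range_succ' (fun k => w^[k] (std n i)) N
      rw [h1]
      rw [h2, hNfix] at h3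
      exact (add_right_cancel h3).symm
    have hx0 : x = 0 := no_fixed l hl hr hs x (by rw [hprod]; exact hx)
    have hpos : 0 < x i := by
      simp only [x, Finset.sum_apply]
      apply Finset.sum_pos'
      · intro k _
        rcases Nat.eq_zero_or_pos k with rfl | hk
        · simp [std_self]
        · obtain ⟨b, hb, h⟩ := wLin_iter σ ε hε i k
          rw [h]
          by_cases hi : (σ ^ k) i = i
          · rcases hb with rfl | rfl
            · simp [hi, std_self]
            · exact absurd (by rw [h, hi]; simp) (hcon k hk)
          · simp [std_ne (Ne.symm hi)]
      · exact ⟨0, by simpa using hNpos, by simp [std_self]⟩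
    rw [hx0] at hpos
    simp at hpos
  · intro h
    obtain ⟨l, hl, hr, hprod, hspan⟩ := construct n (Finset.univ) (by simp) (wLin σ ε)
      (by
        intro x y hxy
        funext p
        have h1 : ε (σ⁻¹ (σ p)) * x (σ⁻¹ (σ p)) = ε (σ⁻¹ (σ p)) * y (σ⁻¹ (σ p)) :=
          congrFun hxy (σ p)
        rw [show σ⁻¹ (σ p) = p by simp] at h1
        rcases hε p with h2 | h2 <;> rw [h2] at h1 <;> linarith)
      (fun p => ⟨σ p, ε p, hε p, wLin_std σ ε p⟩)
      (by simp)
      (fun i _ => by obtain ⟨k, _, hk⟩ := h i; exact ⟨k, hk⟩)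
    refine ⟨l, hl, hr, hprod, ?_⟩
    rw [eq_top_iff, ← (Pi.basisFun ℤ (Fin n)).span_eq, Submodule.span_le]
    rintro _ ⟨i, rfl⟩
    simpa [std] using hspan i (Finset.mem_univ i)
end
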